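/- Suppose that for every finite planar point set S in general position and all distinct p, q ∈ S, the flip graph on the set of plane spanning paths of S that start with the edge pq (first vertex p, second vertex q) is connected. Then for every such S and every p ∈ S, the flip graph on the set of plane spanning paths of S starting at p is connected. -/

import Mathlib

open scoped Classical

noncomputable section

abbrev Pt : Type := ℝ × ℝ

/-- default point -/
def pd : Pt := (0, 0)

/-- No three distinct points of `S` are collinear. -/
def GenPos (S : Finset Pt) : Prop :=
  ∀ p ∈ S, ∀ q ∈ S, ∀ r ∈ S, p ≠ q → p ≠ r → q ≠ r →
    ¬ Collinear ℝ ({p, q, r} : Set Pt)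

/-- The (ordered) edges of a path given as a list of vertices. -/
def pathEdges (l : List Pt) : List (Pt × Pt) := l.zip l.tail

/-- The (ordered) edges of a cycle given as a list of vertices. -/
def cycleEdges (l : List Pt) : List (Pt × Pt) := l.zip (l.rotate 1)

/-- A family of straight-line segments is pairwise non-crossing:
the open segments of any two distinct members are disjoint. -/
def NonCrossing (E : List (Pt × Pt)) : Prop :=
  E.Pairwise fun e f => openSegment ℝ e.1 e.2 ∩ openSegment ℝ f.1 f.2 = ∅

/-- `l` is a plane (crossing-free) straight-line spanning path of `S`. -/
def IsPlanePath (S : Finset Pt) (l : List Pt) : Prop :=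
  l.Nodup ∧ l.toFinset = S ∧ NonCrossing (pathEdges l)

/-- `l` is a plane straight-line spanning cycle of `S`. -/
def IsPlaneCycle (S : Finset Pt) (l : List Pt) : Prop :=
  3 ≤ l.length ∧ l.Nodup ∧ l.toFinset = S ∧ NonCrossing (cycleEdges l)

/-- The set of edges of a path, as unordered pairs. -/
def edgeSet (l : List Pt) : Finset (Sym2 Pt) :=
  ((pathEdges l).map fun e => s(e.1, e.2)).toFinset

/-- The set of edges of a cycle, as unordered pairs. -/
def cycleEdgeSet (l : List Pt) : Finset (Sym2 Pt) :=
  ((cycleEdges l).map fun e => s(e.1, e.2)).toFinset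

/-- No segment joining two points of `S` crosses any edge of the cycle `l`. -/
def UncrossedCycle (S : Finset Pt) (l : List Pt) : Prop :=
  ∀ a ∈ S, ∀ b ∈ S, a ≠ b → ∀ e ∈ cycleEdges l, s(a, b) ≠ s(e.1, e.2) →
    openSegment ℝ a b ∩ openSegment ℝ e.1 e.2 = ∅

/-- Two plane spanning paths of `S` differ by a single flip. -/
def FlipAdj (S : Finset Pt) (P Q : List Pt) : Prop :=
  IsPlanePath S P ∧ IsPlanePath S Q ∧
    ∃ e f, e ≠ f ∧ e ∈ edgeSet P ∧ f ∈ edgeSet Q ∧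
      (edgeSet P).erase e = (edgeSet Q).erase f

/-- There is a sequence of `k` flips from `P` to (a representative of) `Q`, all of whose
members are plane spanning paths of `S` satisfying the additional property `A`. -/
def FlipSeq (S : Finset Pt) (A : List Pt → Prop) (k : ℕ) (P Q : List Pt) : Prop :=
  ∃ f : ℕ → List Pt, f 0 = P ∧ edgeSet (f k) = edgeSet Q ∧
    (∀ i ≤ k, IsPlanePath S (f i) ∧ A (f i)) ∧
    ∀ i < k, FlipAdj S (f i) (f (i + 1))

/-- The flip graph on the plane spanning paths of `S` satisfying `A` is connected. -/
def FlipConnected (S : Finset Pt) (A : List Pt → Prop) : Prop :=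
  ∀ P Q : List Pt, IsPlanePath S P → A P → IsPlanePath S Q → A Q →
    ∃ k, FlipSeq S A k P Q

/-- `uv` is an edge of the boundary of the convex hull of `S`. -/
def HullEdge (S : Finset Pt) (u v : Pt) : Prop :=
  u ∈ S ∧ v ∈ S ∧ u ≠ v ∧ segment ℝ u v ⊆ frontier (convexHull ℝ (S : Set Pt))

/-- `p` is an extreme point (a vertex of the convex hull) of `S`. -/
def ExtremePt (S : Finset Pt) (p : Pt) : Prop :=
  p ∈ S ∧ p ∉ convexHull ℝ ((S.erase p : Finset Pt) : Set Pt)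

/-- `p` is a point of `S` lying strictly in the interior of the convex hull of `S`. -/
def InteriorPt (S : Finset Pt) (p : Pt) : Prop :=
  p ∈ S ∧ p ∈ interior (convexHull ℝ (S : Set Pt))

/-- Twice the signed area of the triangle `a b c` (orientation test). -/
def sign3 (a b c : Pt) : ℝ :=
  (b.1 - a.1) * (c.2 - a.2) - (b.2 - a.2) * (c.1 - a.1)

theorem pathEdges_append {l₁ l₂ : List Pt} {u v : Pt} (h₁ : l₁.getLast? = some u)
    (h₂ : l₂.head? = some v) :
    pathEdges (l₁ ++ l₂) = pathEdges l₁ ++ (u, v) :: pathEdges l₂ := by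
  induction l₁ with
  | nil => simp at h₁
  | cons a t ih =>
    cases t with
    | nil =>
      cases l₂ with
      | nil => simp at h₂
      | cons b t => simp_all [pathEdges]
    | cons b t =>
      have := ih (by simpa using h₁)
      simpa [pathEdges] using this

theorem pathEdges_cons {l : List Pt} {p q : Pt} (h : l.head? = some q) :
    pathEdges (p :: l) = (p, q) :: pathEdges l := by
  simpa [pathEdges] using pathEdges_append (l₁ := [p]) (u := p) (by simp) h

theorem pathEdges_reverse (l : List Pt) :
    pathEdges l.reverse = ((pathEdges l).map Prod.swap).reverse := by
  induction l with
  | nil => rfl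
  | cons a t ih =>
    cases t with
    | nil => rfl
    | cons b t =>
      rw [List.reverse_cons, pathEdges_append (u := b) (v := a) (by simp) (by simp), ih,
        pathEdges_cons (l := b :: t) (q := b) rfl]
      simp [show pathEdges [a] = [] from rfl]

theorem mem_of_mem_pathEdges {l : List Pt} {e : Pt × Pt} (h : e ∈ pathEdges l) :
    e.1 ∈ l ∧ e.2 ∈ l :=
  ⟨(List.of_mem_zip h).1, List.mem_of_mem_tail (List.of_mem_zip h).2⟩

theorem ne_of_mem_pathEdges {l : List Pt} (hl : l.Nodup) {e : Pt × Pt} (h : e ∈ pathEdges l) :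
    e.1 ≠ e.2 := by
  induction l with
  | nil => simp [pathEdges] at h
  | cons a t ih =>
    cases t with
    | nil => simp [pathEdges] at h
    | cons b t =>
      rw [pathEdges_cons (q := b) (by simp), List.mem_cons] at h
      rcases h with rfl | h
      · exact fun h => (List.nodup_cons.1 hl).1 (by simp [show a = b from h])
      · exact ih hl.of_cons h

/-- The open segments `ab` and `cd` are disjoint. -/
def Apart (a b c d : Pt) : Prop := openSegment ℝ a b ∩ openSegment ℝ c d = ∅

theorem Apart.symm {a b c d : Pt} (h : Apart a b c d) : Apart c d a b := by
  rwa [Apart, Set.inter_comm]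

theorem Apart.swap_left {a b c d : Pt} (h : Apart a b c d) : Apart b a c d := by
  rwa [Apart, openSegment_symm]

theorem Apart.swap_right {a b c d : Pt} (h : Apart a b c d) : Apart a b d c :=
  h.symm.swap_left.symm

theorem NonCrossing.cons {l : List Pt} {p q : Pt} (hq : l.head? = some q)
    (hl : NonCrossing (pathEdges l)) (h : ∀ e ∈ pathEdges l, Apart p q e.1 e.2) :
    NonCrossing (pathEdges (p :: l)) := by
  rw [pathEdges_cons hq]
  exact List.pairwise_cons.2 ⟨h, hl⟩

theorem NonCrossing.append {l₁ l₂ : List Pt} {u v : Pt} (hu : l₁.getLast? = some u)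
    (hv : l₂.head? = some v) (h₁ : NonCrossing (pathEdges l₁)) (h₂ : NonCrossing (pathEdges l₂))
    (h₁₂ : ∀ e ∈ pathEdges l₁, ∀ f ∈ pathEdges l₂, Apart e.1 e.2 f.1 f.2)
    (h₁' : ∀ e ∈ pathEdges l₁, Apart u v e.1 e.2) (h₂' : ∀ e ∈ pathEdges l₂, Apart u v e.1 e.2) :
    NonCrossing (pathEdges (l₁ ++ l₂)) := by
  rw [pathEdges_append hu hv]
  refine List.pairwise_append.2 ⟨h₁, List.pairwise_cons.2 ⟨h₂', h₂⟩, fun e he f hf => ?_⟩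
  rcases List.mem_cons.1 hf with rfl | hf
  · exact (h₁' e he).symm
  · exact h₁₂ e he f hf

theorem NonCrossing.reverse {l : List Pt} (h : NonCrossing (pathEdges l)) :
    NonCrossing (pathEdges l.reverse) := by
  rw [pathEdges_reverse]
  refine List.pairwise_reverse.2 (List.pairwise_map.2 (h.imp ?_))
  intro e f h
  exact (Apart.symm h).swap_left.swap_right

theorem IsPlanePath.reverse {S : Finset Pt} {l : List Pt} (h : IsPlanePath S l) :
    IsPlanePath S l.reverse :=
  ⟨List.nodup_reverse.2 h.1, by rw [List.toFinset_reverse, h.2.1], h.2.2.reverse⟩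

theorem IsPlanePath.mem_iff {S : Finset Pt} {l : List Pt} (h : IsPlanePath S l) {x : Pt} :
    x ∈ l ↔ x ∈ S := by
  rw [← h.2.1, List.mem_toFinset]

theorem edgeSet_reverse (l : List Pt) : edgeSet l.reverse = edgeSet l := by
  ext x
  simp [edgeSet, pathEdges_reverse, Sym2.eq_swap]

theorem edgeSet_cons {l : List Pt} {p q : Pt} (h : l.head? = some q) :
    edgeSet (p :: l) = insert s(p, q) (edgeSet l) := by
  simp [edgeSet, pathEdges_cons h]

theorem mk_notMem_edgeSet {l : List Pt} {p : Pt} (h : p ∉ l) (q : Pt) :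
    s(p, q) ∉ edgeSet l := by
  intro hm
  simp only [edgeSet, List.mem_toFinset, List.mem_map] at hm
  obtain ⟨e, he, heq⟩ := hm
  obtain ⟨h1, h2⟩ := mem_of_mem_pathEdges he
  rcases Sym2.eq_iff.1 heq with ⟨h', -⟩ | ⟨-, h'⟩
  · exact h (h' ▸ h1)
  · exact h (h' ▸ h2)

/-- The two paths obtained by deleting one of the two edges at `p` of a cycle differ by a flip. -/
theorem flipAdj_cons_reverse {S : Finset Pt} {l : List Pt} {p q r : Pt} (hq : l.head? = some q)
    (hr : l.getLast? = some r) (hqr : q ≠ r) (h₁ : IsPlanePath S (p :: l))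
    (h₂ : IsPlanePath S (p :: l.reverse)) : FlipAdj S (p :: l) (p :: l.reverse) := by
  have hp : p ∉ l := (List.nodup_cons.1 h₁.1).1
  have hr' : l.reverse.head? = some r := by simpa using hr
  refine ⟨h₁, h₂, s(p, q), s(p, r), ?_, ?_, ?_, ?_⟩
  · exact fun h => hqr (Sym2.congr_right.1 h)
  · simp [edgeSet_cons hq]
  · simp [edgeSet_cons hr']
  · rw [edgeSet_cons hq, edgeSet_cons hr', edgeSet_reverse,
      Finset.erase_insert (mk_notMem_edgeSet hp q), Finset.erase_insert (mk_notMem_edgeSet hp r)]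

theorem FlipAdj.symm {S : Finset Pt} {P Q : List Pt} (h : FlipAdj S P Q) : FlipAdj S Q P := by
  obtain ⟨hP, hQ, e, f, hne, he, hf, h⟩ := h
  exact ⟨hQ, hP, f, e, hne.symm, hf, he, h.symm⟩

theorem FlipAdj.congr_left {S : Finset Pt} {P P' Q : List Pt} (h : FlipAdj S P Q)
    (hP' : IsPlanePath S P') (he : edgeSet P' = edgeSet P) : FlipAdj S P' Q := by
  obtain ⟨-, hQ, h⟩ := h
  exact ⟨hP', hQ, by rwa [he]⟩

theorem FlipSeq.single {S : Finset Pt} {A : List Pt → Prop} {P Q : List Pt}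
    (h : FlipAdj S P Q) (hP : A P) (hQ : A Q) : FlipSeq S A 1 P Q := by
  refine ⟨fun i => if i = 0 then P else Q, by simp, by simp, fun i _ => ?_, fun i hi => ?_⟩
  · dsimp only
    split_ifs
    exacts [⟨h.1, hP⟩, ⟨h.2.1, hQ⟩]
  · obtain rfl : i = 0 := by omega
    simpa using h

theorem FlipSeq.mono {S : Finset Pt} {A B : List Pt → Prop} (hAB : ∀ l, A l → B l) {k : ℕ}
    {P Q : List Pt} (h : FlipSeq S A k P Q) : FlipSeq S B k P Q := by
  obtain ⟨f, h0, hk, hA, hf⟩ := h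
  exact ⟨f, h0, hk, fun i hi => ⟨(hA i hi).1, hAB _ (hA i hi).2⟩, hf⟩

theorem FlipSeq.symm {S : Finset Pt} {A : List Pt → Prop} {k : ℕ} {P Q : List Pt}
    (h : FlipSeq S A k P Q) (hQ : IsPlanePath S Q) (hQA : A Q) : FlipSeq S A k Q P := by
  obtain ⟨f, h0, hk, hA, hf⟩ := h
  refine ⟨fun i => if i = 0 then Q else f (k - i), by simp, ?_, fun i hi => ?_, fun i hi => ?_⟩
  · dsimp only
    split_ifs with h
    · subst h
      rw [← hk, h0]
    · rw [Nat.sub_self, h0]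
  · dsimp only
    split_ifs
    · exact ⟨hQ, hQA⟩
    · exact hA _ (by omega)
  · have h1 := (hf (k - (i + 1)) (by omega)).symm
    rw [show k - (i + 1) + 1 = k - i by omega] at h1
    rcases Nat.eq_zero_or_pos i with rfl | hi0
    · simpa using h1.congr_left hQ hk.symm
    · simpa [hi0.ne'] using h1

theorem FlipSeq.trans {S : Finset Pt} {A : List Pt → Prop} {j k : ℕ} {P Q R : List Pt}
    (h₁ : FlipSeq S A j P Q) (h₂ : FlipSeq S A k Q R) : FlipSeq S A (j + k) P R := by
  obtain ⟨f, f0, fj, fA, hf⟩ := h₁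
  obtain ⟨g, g0, gk, gA, hg⟩ := h₂
  refine ⟨fun i => if i ≤ j then f i else g (i - j), by simp [f0], ?_, fun i hi => ?_,
    fun i hi => ?_⟩
  · dsimp only
    split_ifs with h
    · obtain rfl : k = 0 := by omega
      rw [Nat.add_zero, fj, ← gk, g0]
    · rw [Nat.add_sub_cancel_left, gk]
  · dsimp only
    split_ifs with h
    · exact fA i h
    · exact gA _ (by omega)
  · dsimp only
    rcases lt_trichotomy i j with h | rfl | h
    · rw [if_pos h.le, if_pos (by omega)]
      exact hf i h
    · rw [if_pos le_rfl, if_neg (by omega), Nat.add_sub_cancel_left]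
      have := hg 0 (by omega)
      rw [g0] at this
      exact this.congr_left (fA i le_rfl).1 fj
    · rw [if_neg (by omega), if_neg (by omega), show i + 1 - j = i - j + 1 by omega]
      exact hg _ (by omega)

theorem sign3_swap (a b c : Pt) : sign3 b a c = -sign3 a b c := by
  simp only [sign3]; ring

theorem sign3_rotate (a b c : Pt) : sign3 b c a = sign3 a b c := by
  simp only [sign3]; ring

theorem sign3_swap_right (a b c : Pt) : sign3 a c b = -sign3 a b c := by
  simp only [sign3]; ring

@[simp] theorem sign3_left (a b : Pt) : sign3 a b a = 0 := by
  simp only [sign3]; ring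

@[simp] theorem sign3_right (a b : Pt) : sign3 a b b = 0 := by
  simp only [sign3]; ring

@[simp] theorem sign3_self (a b : Pt) : sign3 a a b = 0 := by
  simp only [sign3]; ring

theorem sign3_plucker (p a b c d : Pt) :
    sign3 p a c * sign3 p b d = sign3 p a b * sign3 p c d + sign3 p a d * sign3 p b c := by
  simp only [sign3]; ring

theorem GenPos.sign3_ne_zero {S : Finset Pt} (hS : GenPos S) {a b c : Pt} (ha : a ∈ S)
    (hb : b ∈ S) (hc : c ∈ S) (hab : a ≠ b) (hac : a ≠ c) (hbc : b ≠ c) : sign3 a b c ≠ 0 := by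
  intro h
  refine hS a ha b hb c hc hab hac hbc ?_
  rw [collinear_iff_of_mem (p₀ := a) (by simp)]
  refine ⟨b - a, ?_⟩
  have key : ∃ r : ℝ, c = r • (b - a) + a := by
    simp only [sign3] at h
    by_cases h1 : b.1 - a.1 = 0
    · have h2 : b.2 - a.2 ≠ 0 := fun h2 => hab (Prod.ext (by linarith) (by linarith))
      have h3 : c.1 - a.1 = 0 := by
        rw [h1] at h
        have : (b.2 - a.2) * (c.1 - a.1) = 0 := by linarith
        exact (mul_eq_zero.1 this).resolve_left h2
      refine ⟨(c.2 - a.2) / (b.2 - a.2), Prod.ext ?_ ?_⟩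
      · simp [h1]; linarith
      · simp [div_mul_cancel₀ _ h2]
    · refine ⟨(c.1 - a.1) / (b.1 - a.1), Prod.ext ?_ ?_⟩
      · simp [div_mul_cancel₀ _ h1]
      · simp only [Prod.snd_add, Prod.smul_snd, Prod.snd_sub, smul_eq_mul]
        field_simp
        linarith
  simp only [Set.mem_insert_iff, Set.mem_singleton_iff, vadd_eq_add]
  rintro x (rfl | rfl | rfl)
  · exact ⟨0, by simp⟩
  · exact ⟨1, by simp⟩
  · exact key

theorem GenPos.mono {S T : Finset Pt} (hS : GenPos S) (h : T ⊆ S) : GenPos T :=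
  fun p hp q hq r hr => hS p (h hp) q (h hq) r (h hr)

theorem sign3_of_mem_openSegment {x y z : Pt} (hz : z ∈ openSegment ℝ x y) :
    ∃ s t : ℝ, 0 < s ∧ 0 < t ∧ ∀ a b, sign3 a b z = s * sign3 a b x + t * sign3 a b y := by
  obtain ⟨s, t, hs, ht, hst, rfl⟩ := hz
  refine ⟨s, t, hs, ht, fun a b => ?_⟩
  obtain rfl : t = 1 - s := by linarith
  simp only [sign3, Prod.fst_add, Prod.snd_add, Prod.smul_fst, Prod.smul_snd, smul_eq_mul]
  ring

/-- Two segments separated by the line `ab`, the first not contained in it, do not cross. -/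
theorem apart_of_sign3 (a b : Pt) {x y z w : Pt} (hx : 0 ≤ sign3 a b x) (hy : 0 ≤ sign3 a b y)
    (hxy : 0 < sign3 a b x + sign3 a b y) (hz : sign3 a b z ≤ 0) (hw : sign3 a b w ≤ 0) :
    Apart x y z w := by
  refine Set.eq_empty_of_forall_notMem fun m hm => ?_
  obtain ⟨s, t, hs, ht, h⟩ := sign3_of_mem_openSegment hm.1
  obtain ⟨s', t', hs', ht', h'⟩ := sign3_of_mem_openSegment hm.2
  have h1 : 0 < sign3 a b m := by
    rw [h]
    rcases hx.lt_or_eq with hx | hx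
    · have := mul_pos hs hx
      have := mul_nonneg ht.le hy
      linarith
    · have := mul_pos ht (show 0 < sign3 a b y by linarith)
      rw [← hx]
      linarith
  have h2 : sign3 a b m ≤ 0 := by
    rw [h']
    have := mul_nonpos_of_nonneg_of_nonpos hs'.le hz
    have := mul_nonpos_of_nonneg_of_nonpos ht'.le hw
    linarith
  linarith

/-- Segments whose endpoints lie on different sides of each other cross. -/
theorem not_apart_of_sign3 {p q u v : Pt} (hu : sign3 p q u < 0) (hv : 0 < sign3 p q v)
    (hp : 0 < sign3 u v p) (hq : sign3 u v q < 0) : ¬ Apart u v p q := by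
  intro h
  have hD : sign3 p q v - sign3 p q u = sign3 u v p - sign3 u v q := by
    simp only [sign3]; ring
  set D := sign3 p q v - sign3 p q u with hDdef
  have hD0 : 0 < D := by linarith
  refine (Set.eq_empty_iff_forall_notMem.1 h) ((sign3 p q v / D) • u + (-sign3 p q u / D) • v)
    ⟨⟨_, _, by positivity, div_pos (by linarith) hD0, ?_, rfl⟩,
      ⟨-sign3 u v q / D, sign3 u v p / D, div_pos (by linarith) hD0, by positivity, ?_, ?_⟩⟩
  · rw [← add_div, div_eq_one_iff_eq hD0.ne', hDdef]; ring
  · rw [← add_div, div_eq_one_iff_eq hD0.ne', hD]; ring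
  · ext
    · simp only [Prod.fst_add, Prod.smul_fst, smul_eq_mul]
      field_simp
      simp only [sign3]; ring
    · simp only [Prod.snd_add, Prod.smul_snd, smul_eq_mul]
      field_simp
      simp only [sign3]; ring

/-- All points of `T` other than `a` lie strictly on one side of a line through `a`. -/
def Exposed (T : Finset Pt) (a : Pt) : Prop :=
  ∃ α β : ℝ, ∀ w ∈ T, w ≠ a → 0 < α * (w.1 - a.1) + β * (w.2 - a.2)

theorem exposed_of_sign3_pos {T : Finset Pt} {a : Pt} (x y : Pt) (ha : sign3 x y a = 0)
    (h : ∀ w ∈ T, w ≠ a → 0 < sign3 x y w) : Exposed T a := by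
  refine ⟨-(y.2 - x.2), y.1 - x.1, fun w hw hwa => ?_⟩
  have := h w hw hwa
  simp only [sign3] at *
  linarith

theorem exposed_of_sign3_neg {T : Finset Pt} {a : Pt} (x y : Pt) (ha : sign3 x y a = 0)
    (h : ∀ w ∈ T, w ≠ a → sign3 x y w < 0) : Exposed T a := by
  refine exposed_of_sign3_pos y x ?_ fun w hw hwa => ?_
  · rw [sign3_swap, ha, neg_zero]
  · rw [sign3_swap]
    exact neg_pos.2 (h w hw hwa)

/-- A radially first (`ε = 1`) or last (`ε = -1`) point of `T` as seen from `a`. -/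
theorem exists_radial_first {T : Finset Pt} {a : Pt} (ha : a ∉ T) (hT : T.Nonempty)
    (hG : GenPos (insert a T)) (hE : Exposed T a) {ε : ℝ} (hε : ε ≠ 0) :
    ∃ c ∈ T, ∀ w ∈ T, w ≠ c → 0 < ε * sign3 a c w := by
  obtain ⟨α, β, h⟩ := hE
  replace h : ∀ w ∈ T, 0 < α * (w.1 - a.1) + β * (w.2 - a.2) := fun w hw =>
    h w hw (ne_of_mem_of_not_mem hw ha)
  obtain ⟨c, hc, hmin⟩ := T.exists_min_image (fun w =>
    ε * (α * (w.2 - a.2) - β * (w.1 - a.1)) / (α * (w.1 - a.1) + β * (w.2 - a.2))) hT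
  refine ⟨c, hc, fun w hw hwc => ?_⟩
  have h1 := hmin w hw
  rw [div_le_div_iff₀ (h c hc) (h w hw)] at h1
  have h2 : 0 ≤ (α ^ 2 + β ^ 2) * (ε * sign3 a c w) := by
    simp only [sign3]
    linarith
  have h3 : 0 < α ^ 2 + β ^ 2 := by
    rcases eq_or_ne α 0 with rfl | hα
    · rcases eq_or_ne β 0 with rfl | hβ
      · simpa using h c hc
      · positivity
    · positivity
  have h4 : ε * sign3 a c w ≠ 0 := mul_ne_zero hε
    (hG.sign3_ne_zero (by simp) (by simp [hc]) (by simp [hw]) (ne_of_mem_of_not_mem hc ha).symm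
      (ne_of_mem_of_not_mem hw ha).symm hwc.symm)
  exact (nonneg_of_mul_nonneg_right h2 h3).lt_of_ne' h4

/-- `l` is a plane spanning path of `T` from `a` to `b`. -/
def PathBetween (T : Finset Pt) (a b : Pt) (l : List Pt) : Prop :=
  IsPlanePath T l ∧ l.head? = some a ∧ l.getLast? = some b

theorem Apart.of_exposed_edge {T : Finset Pt} {a c : Pt} {ε : ℝ}
    (h : ∀ w ∈ T, w ≠ c → 0 < ε * sign3 a c w) {x y : Pt} (hx : x ∈ T) (hy : y ∈ T)
    (hxy : x ≠ y) : Apart a c x y := by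
  have key : ∀ w ∈ T, 0 ≤ ε * sign3 a c w := fun w hw => by
    rcases eq_or_ne w c with rfl | hwc
    · simp
    · exact (h w hw hwc).le
  have h1 : 0 < ε * sign3 a c x + ε * sign3 a c y := by
    rcases eq_or_ne x c with rfl | hxc
    · simpa using h y hy hxy.symm
    · have := h x hx hxc
      have := key y hy
      linarith
  have kx := key x hx
  have ky := key y hy
  rw [← mul_add] at h1
  rcases lt_trichotomy ε 0 with hε | rfl | hε
  · refine Apart.symm (apart_of_sign3 c a ?_ ?_ ?_ ?_ ?_) <;> simp only [sign3_swap a c] <;>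
      try simp only [sign3_left, sign3_right, neg_zero, le_refl]
    · exact neg_nonneg.2 (nonpos_of_mul_nonneg_right kx hε)
    · exact neg_nonneg.2 (nonpos_of_mul_nonneg_right ky hε)
    · have := neg_of_mul_pos_right h1 hε.le
      linarith
  · simp at h1
  · refine Apart.symm (apart_of_sign3 a c ?_ ?_ ?_ (by simp) (by simp))
    · exact nonneg_of_mul_nonneg_right kx hε
    · exact nonneg_of_mul_nonneg_right ky hε
    · exact pos_of_mul_pos_right h1 hε.le

/-- There is a plane spanning path from any exposed point to any other point. -/
theorem exists_pathBetween {T : Finset Pt} (hG : GenPos T) {a b : Pt} (ha : a ∈ T) (hb : b ∈ T)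
    (hE : Exposed T a) (hab : a = b → T = {a}) : ∃ l, PathBetween T a b l := by
  induction hn : T.card using Nat.strong_induction_on generalizing T a with
  | _ n ih =>
  subst hn
  by_cases hab' : a = b
  · refine ⟨[a], ⟨by simp, by simp [hab hab'], by simp [NonCrossing, pathEdges]⟩, by simp,
      by simp [hab']⟩
  have hbT : b ∈ T.erase a := Finset.mem_erase.2 ⟨Ne.symm hab', hb⟩
  have hG' : GenPos (insert a (T.erase a)) := by rwa [Finset.insert_erase ha]
  have hE' : Exposed (T.erase a) a := by
    obtain ⟨α, β, h⟩ := hE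
    exact ⟨α, β, fun w hw => h w (Finset.mem_of_mem_erase hw)⟩
  have hc : ∃ c ∈ T.erase a, (c = b → T.erase a = {c}) ∧
      ∃ ε : ℝ, ε ≠ 0 ∧ ∀ w ∈ T.erase a, w ≠ c → 0 < ε * sign3 a c w := by
    obtain ⟨c₁, h₁, h₁'⟩ := exists_radial_first (Finset.notMem_erase a T) ⟨b, hbT⟩ hG' hE'
      one_ne_zero
    obtain ⟨c₂, h₂, h₂'⟩ := exists_radial_first (Finset.notMem_erase a T) ⟨b, hbT⟩ hG' hE'
      (neg_ne_zero.2 one_ne_zero)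
    by_cases h : c₁ = b
    · refine ⟨c₂, h₂, fun h2 => ?_, -1, by norm_num, h₂'⟩
      refine Finset.eq_singleton_iff_unique_mem.2 ⟨h₂, fun w hw => ?_⟩
      by_contra hne
      have e1 := h₁' w hw (by rwa [h, ← h2])
      have e2 := h₂' w hw hne
      rw [h] at e1
      rw [h2] at e2
      linarith
    · exact ⟨c₁, h₁, fun h' => absurd h' h, 1, one_ne_zero, h₁'⟩
  obtain ⟨c, hcT, hcb, ε, hε, hside⟩ := hc
  have hcE : Exposed (T.erase a) c := by
    rcases hε.lt_or_gt with h | h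
    · exact exposed_of_sign3_neg a c (by simp) fun w hw hwc =>
        neg_of_mul_pos_right (hside w hw hwc) h.le
    · exact exposed_of_sign3_pos a c (by simp) fun w hw hwc =>
        pos_of_mul_pos_right (hside w hw hwc) h.le
  obtain ⟨l, hl, hlc, hlb⟩ := ih _ (Finset.card_erase_lt_of_mem ha)
    (hG.mono (Finset.erase_subset _ _)) hcT hbT hcE hcb rfl
  refine ⟨a :: l, ⟨?_, ?_, ?_⟩, by simp, ?_⟩
  · exact List.nodup_cons.2 ⟨by rw [hl.mem_iff]; simp, hl.1⟩
  · rw [List.toFinset_cons, hl.2.1, Finset.insert_erase ha]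
  · refine hl.2.2.cons hlc fun e he => ?_
    obtain ⟨h1, h2⟩ := mem_of_mem_pathEdges he
    exact Apart.of_exposed_edge hside (hl.mem_iff.1 h1) (hl.mem_iff.1 h2)
      (ne_of_mem_pathEdges hl.1 he)
  · rw [List.getLast?_cons, hlb]
    rfl

/-- The points of `S` to the left of the directed line `pq`. -/
def leftOf (S : Finset Pt) (p q : Pt) : Finset Pt := S.filter fun w => 0 < sign3 p q w

/-- The points of `S` to the right of the directed line `pq`. -/
def rightOf (S : Finset Pt) (p q : Pt) : Finset Pt := S.filter fun w => sign3 p q w < 0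

theorem mem_leftOf {S : Finset Pt} {p q w : Pt} : w ∈ leftOf S p q ↔ w ∈ S ∧ 0 < sign3 p q w :=
  Finset.mem_filter

theorem mem_rightOf {S : Finset Pt} {p q w : Pt} : w ∈ rightOf S p q ↔ w ∈ S ∧ sign3 p q w < 0 :=
  Finset.mem_filter

theorem ne_of_sign3_ne_zero {p q w : Pt} (h : sign3 p q w ≠ 0) : w ≠ p ∧ w ≠ q :=
  ⟨by rintro rfl; simp at h, by rintro rfl; simp at h⟩

/-- Gluing a path of the points right of `pq`, starting at `q`, and a path of the points left of
`pq` along an edge `uv` gives a plane cycle through the edges `pq` and `pr`. -/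
theorem exists_flip_of_paths {S : Finset Pt} (hG : GenPos S) {p q r u v : Pt} (hp : p ∈ S)
    (hq : q ∈ S) (hpq : p ≠ q) {l m : List Pt}
    (hl : PathBetween (insert q (rightOf S p q)) q u l)
    (hm : PathBetween (leftOf S p q) r v m) (hpm : NonCrossing (pathEdges (p :: m)))
    (hA : ∀ x ∈ insert q (rightOf S p q), ∀ y ∈ insert q (rightOf S p q), x ≠ y → Apart v u x y)
    (hB : ∀ x ∈ insert p (leftOf S p q), ∀ y ∈ insert p (leftOf S p q), x ≠ y → Apart v u x y)
    (hpqvu : Apart v u p q) :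
    ∃ P Q : List Pt, P.head? = some p ∧ P.tail.head? = some q ∧ Q.head? = some p ∧
      Q.tail.head? = some r ∧ FlipAdj S P Q := by
  obtain ⟨hl, hlq, hlu⟩ := hl
  obtain ⟨hm, hmr, hmv⟩ := hm
  have hl' : ∀ x ∈ l, sign3 p q x ≤ 0 ∧ (x ≠ q → sign3 p q x < 0) := by
    intro x hx
    rw [hl.mem_iff, Finset.mem_insert, mem_rightOf] at hx
    rcases hx with rfl | hx
    · simp
    · exact ⟨hx.2.le, fun _ => hx.2⟩
  have hm' : ∀ x ∈ m, 0 < sign3 p q x := fun x hx => (mem_leftOf.1 (hm.mem_iff.1 hx)).2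
  have hpl : p ∉ l := fun h => by simpa using (hl' p h).2 hpq
  have hpm' : p ∉ m := fun h => by simpa using hm' p h
  have hlm : ∀ e ∈ pathEdges l, ∀ x y, 0 ≤ sign3 p q x → 0 ≤ sign3 p q y →
      Apart x y e.1 e.2 := by
    intro e he x y hx hy
    obtain ⟨h1, h2⟩ := mem_of_mem_pathEdges he
    have hne := ne_of_mem_pathEdges hl.1 he
    refine (apart_of_sign3 q p ?_ ?_ ?_ ?_ ?_).symm <;> rw [sign3_swap p q]
    · linarith [(hl' _ h1).1]
    · linarith [(hl' _ h2).1]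
    · rw [sign3_swap p q]
      rcases eq_or_ne e.1 q with h | h
      · linarith [(hl' _ h1).1, (hl' _ h2).2 (h ▸ hne.symm)]
      · linarith [(hl' _ h1).2 h, (hl' _ h2).1]
    · linarith
    · linarith
  have hpm0 : ∀ x ∈ p :: m, 0 ≤ sign3 p q x := by
    intro x hx
    rcases List.mem_cons.1 hx with rfl | hx
    · simp
    · exact (hm' x hx).le
  have hpmB : ∀ x ∈ p :: m, x ∈ insert p (leftOf S p q) := fun x hx => by
    rcases List.mem_cons.1 hx with rfl | hx
    · simp
    · exact Finset.mem_insert_of_mem (hm.mem_iff.1 hx)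
  have hlr : l.reverse.head? = some u := by simpa using hlu
  have hmr' : m.reverse.head? = some v := by simpa using hmv
  have hmrl : (p :: m).getLast? = some v := by
    rw [List.getLast?_cons, hmv]
    rfl
  have hnd : (m ++ l.reverse).Nodup := by
    refine List.nodup_append'.2 ⟨hm.1, List.nodup_reverse.2 hl.1, fun x hx hx' => ?_⟩
    have h1 := hm' x hx
    have h2 := (hl' x (List.mem_reverse.1 hx')).1
    linarith
  have hpk : p ∉ m ++ l.reverse := by simp [hpl, hpm']
  have hset : ∀ x, x = p ∨ x ∈ m ++ l.reverse ↔ x ∈ S := by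
    intro x
    simp only [List.mem_append, List.mem_reverse, hm.mem_iff, hl.mem_iff, mem_leftOf,
      mem_rightOf, Finset.mem_insert]
    constructor
    · rintro (rfl | h | rfl | h)
      exacts [hp, h.1, hq, h.1]
    · intro hx
      by_cases hxp : x = p
      · exact Or.inl hxp
      by_cases hxq : x = q
      · exact Or.inr (Or.inr (Or.inl hxq))
      rcases (hG.sign3_ne_zero hp hq hx hpq (Ne.symm hxp) (Ne.symm hxq)).lt_or_gt with h | h
      · exact Or.inr (Or.inr (Or.inr ⟨hx, h⟩))
      · exact Or.inr (Or.inl ⟨hx, h⟩)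
  have hplane : NonCrossing (pathEdges (p :: (m ++ l.reverse))) := by
    refine NonCrossing.append (l₁ := p :: m) hmrl hlr hpm hl.reverse.2.2 ?_ ?_ ?_
    · intro e he f hf
      obtain ⟨h1, h2⟩ := mem_of_mem_pathEdges he
      rw [pathEdges_reverse, List.mem_reverse, List.mem_map] at hf
      obtain ⟨f, hf, rfl⟩ := hf
      exact (hlm f hf _ _ (hpm0 _ h1) (hpm0 _ h2)).swap_right
    · intro e he
      obtain ⟨h1, h2⟩ := mem_of_mem_pathEdges he
      exact hB _ (hpmB _ h1) _ (hpmB _ h2)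
        (ne_of_mem_pathEdges (List.nodup_cons.2 ⟨hpm', hm.1⟩) he)
    · intro e he
      obtain ⟨h1, h2⟩ := mem_of_mem_pathEdges he
      exact hA _ (hl.reverse.mem_iff.1 h1) _ (hl.reverse.mem_iff.1 h2)
        (ne_of_mem_pathEdges (List.nodup_reverse.2 hl.1) he)
  have hlplane : NonCrossing (pathEdges (m ++ l.reverse)) := by
    rw [pathEdges_cons (q := r) (by simp [hmr])] at hplane
    exact (List.pairwise_cons.1 hplane).2
  have hplane' : NonCrossing (pathEdges (p :: (m ++ l.reverse).reverse)) := by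
    refine hlplane.reverse.cons (q := q) (by simp [hlq]) fun e he => ?_
    rw [List.reverse_append, List.reverse_reverse, pathEdges_append hlu hmr',
      List.mem_append, List.mem_cons] at he
    rcases he with he | rfl | he
    · exact hlm e he _ _ (by simp) (by simp)
    · exact hpqvu.symm.swap_right
    · obtain ⟨h1, h2⟩ := mem_of_mem_pathEdges he
      have h1' := hm' _ (List.mem_reverse.1 h1)
      have h2' := hm' _ (List.mem_reverse.1 h2)
      exact (apart_of_sign3 p q h1'.le h2'.le (by linarith) (by simp) (by simp)).symm
  have hP : IsPlanePath S (p :: (m ++ l.reverse)) :=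
    ⟨List.nodup_cons.2 ⟨hpk, hnd⟩, by ext x; rw [← hset x]; simp, hplane⟩
  have hQ : IsPlanePath S (p :: (m ++ l.reverse).reverse) :=
    ⟨List.nodup_cons.2 ⟨by rwa [List.mem_reverse], List.nodup_reverse.2 hnd⟩,
      by ext x; rw [← hset x]; simp [or_comm], hplane'⟩
  have hrq : r ≠ q := by
    rintro rfl
    have : r ∈ m := List.mem_of_mem_head? (by simp [hmr])
    simpa using hm' r this
  exact ⟨_, _, rfl, by simp [hlq], rfl, by simp [hmr],
    (flipAdj_cons_reverse (q := r) (r := q) (by simp [hmr]) (by simp [hlq]) hrq hP hQ).symm⟩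

theorem exposed_right {S : Finset Pt} (p q : Pt) : Exposed (insert q (rightOf S p q)) q := by
  refine exposed_of_sign3_neg p q (by simp) fun w hw hwq => ?_
  exact (mem_rightOf.1 ((Finset.mem_insert.1 hw).resolve_left hwq)).2

theorem exposed_left {S : Finset Pt} (p q : Pt) : Exposed (insert p (leftOf S p q)) p := by
  refine exposed_of_sign3_pos p q (by simp) fun w hw hwp => ?_
  exact (mem_leftOf.1 ((Finset.mem_insert.1 hw).resolve_left hwp)).2

theorem Exposed.mono {S T : Finset Pt} {a : Pt} (h : Exposed S a) (hTS : T ⊆ S) :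
    Exposed T a := by
  obtain ⟨α, β, h⟩ := h
  exact ⟨α, β, fun w hw => h w (hTS hw)⟩

theorem insert_rightOf_subset {S : Finset Pt} {a p q : Pt} (ha : a ∈ S) :
    insert a (rightOf S p q) ⊆ S :=
  Finset.insert_subset ha (Finset.filter_subset _ _)

theorem insert_leftOf_subset {S : Finset Pt} {a p q : Pt} (ha : a ∈ S) :
    insert a (leftOf S p q) ⊆ S :=
  Finset.insert_subset ha (Finset.filter_subset _ _)

theorem exists_first_left {S : Finset Pt} (hG : GenPos S) {p q : Pt} (hp : p ∈ S)
    (hne : (leftOf S p q).Nonempty) {ε : ℝ} (hε : ε ≠ 0) :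
    ∃ c ∈ leftOf S p q, ∀ w ∈ leftOf S p q, w ≠ c → 0 < ε * sign3 p c w :=
  exists_radial_first (by simp [mem_leftOf]) hne (hG.mono (insert_leftOf_subset hp))
    ((exposed_left p q).mono (Finset.subset_insert _ _)) hε

/-- If every open half-plane bounded by a line through `p` and another point contains a point of
`S`, then radially consecutive points are neighbours of `p` on a plane spanning cycle. -/
theorem exists_flip_of_surrounded {S : Finset Pt} (hG : GenPos S) {p q r : Pt} (hp : p ∈ S)
    (hI : ∀ m ∈ S, m ≠ p → (leftOf S p m).Nonempty) (hq : q ∈ S) (hpq : p ≠ q)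
    (hr : r ∈ leftOf S p q) (hfirst : ∀ w ∈ leftOf S p q, w ≠ r → 0 < sign3 p r w) :
    ∃ P Q : List Pt, P.head? = some p ∧ P.tail.head? = some q ∧ Q.head? = some p ∧
      Q.tail.head? = some r ∧ FlipAdj S P Q := by
  obtain ⟨v, hv, hvlast⟩ := exists_first_left hG hp ⟨r, hr⟩ (neg_ne_zero.2 one_ne_zero)
  replace hvlast : ∀ w ∈ leftOf S p q, w ≠ v → sign3 p v w < 0 := fun w hw hwv => by
    linarith [hvlast w hw hwv]
  obtain ⟨hvS, hqv⟩ := mem_leftOf.1 hv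
  obtain ⟨hrS, hqr⟩ := mem_leftOf.1 hr
  have hvp := (ne_of_sign3_ne_zero hqv.ne').1
  have hvq : sign3 p v q < 0 := by rw [sign3_swap_right]; linarith
  have hRne : (rightOf S p q).Nonempty := by
    obtain ⟨w, hw⟩ := hI v hvS hvp
    obtain ⟨hwS, hvw⟩ := mem_leftOf.1 hw
    obtain ⟨hwp, hwv⟩ := ne_of_sign3_ne_zero hvw.ne'
    refine ⟨w, mem_rightOf.2 ⟨hwS, ?_⟩⟩
    by_contra! h
    have hwq : w ≠ q := by rintro rfl; linarith
    have := hvlast w (mem_leftOf.2 ⟨hwS, h.lt_of_ne'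
      (hG.sign3_ne_zero hp hq hwS hpq hwp.symm hwq.symm)⟩) hwv
    linarith
  obtain ⟨u, hu, hufirst⟩ : ∃ c ∈ rightOf S p q, ∀ w ∈ rightOf S p q, w ≠ c →
      0 < 1 * sign3 p c w := by
    refine exists_radial_first (by simp [mem_rightOf]) hRne (hG.mono (insert_rightOf_subset hp))
      ?_ one_ne_zero
    exact exposed_of_sign3_neg p q (by simp) fun w hw _ => (mem_rightOf.1 hw).2
  simp only [one_mul] at hufirst
  obtain ⟨huS, hqu⟩ := mem_rightOf.1 hu
  obtain ⟨hup, huq⟩ := ne_of_sign3_ne_zero hqu.ne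
  have huq' : 0 < sign3 p u q := by rw [sign3_swap_right]; linarith
  have huv : u ≠ v := by rintro rfl; linarith
  have hvu : 0 < sign3 p v u := by
    by_contra! h
    obtain ⟨w, hw⟩ := hI v hvS hvp
    obtain ⟨hwS, hvw⟩ := mem_leftOf.1 hw
    obtain ⟨hwp, hwv⟩ := ne_of_sign3_ne_zero hvw.ne'
    have hwq : w ≠ q := by rintro rfl; linarith
    rcases (hG.sign3_ne_zero hp hq hwS hpq hwp.symm hwq.symm).lt_or_gt with hs | hs
    · have hwu : w ≠ u := by rintro rfl; linarith
      have h1 := hufirst w (mem_rightOf.2 ⟨hwS, hs⟩) hwu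
      have h2 := sign3_plucker p v u w q
      have h3 : 0 < sign3 p w q := by rw [sign3_swap_right]; linarith
      have h4 := mul_pos hvw huq'
      have h5 := mul_nonpos_of_nonpos_of_nonneg h h3.le
      have h6 := mul_neg_of_neg_of_pos hvq h1
      linarith
    · linarith [hvlast w (mem_leftOf.2 ⟨hwS, hs⟩) hwv]
  have hL : ∀ x ∈ insert p (leftOf S p q), sign3 p v x ≤ 0 := by
    intro x hx
    rcases Finset.mem_insert.1 hx with rfl | hx
    · simp
    · rcases eq_or_ne x v with rfl | hxv
      · simp
      · exact (hvlast x hx hxv).le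
  have hR : ∀ x ∈ insert q (rightOf S p q), 0 ≤ sign3 p u x := by
    intro x hx
    rcases Finset.mem_insert.1 hx with rfl | hx
    · exact huq'.le
    · rcases eq_or_ne x u with rfl | hxu
      · simp
      · exact (hufirst x hx hxu).le
  have hvuL : ∀ x y, sign3 p v x ≤ 0 → sign3 p v y ≤ 0 → Apart v u x y := fun x y hx hy =>
    apart_of_sign3 p v (by simp) hvu.le (by simpa using hvu) hx hy
  obtain ⟨l, hl⟩ := exists_pathBetween (hG.mono (insert_rightOf_subset hq))
    (Finset.mem_insert_self q (rightOf S p q)) (Finset.mem_insert_of_mem hu) (exposed_right p q)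
    fun h => absurd h.symm huq
  obtain ⟨m, hm⟩ := exists_pathBetween (T := leftOf S p q) (hG.mono (Finset.filter_subset _ _))
    hr hv (exposed_of_sign3_pos p r (by simp) hfirst) (by
      rintro rfl
      refine Finset.eq_singleton_iff_unique_mem.2 ⟨hr, fun w hw => ?_⟩
      by_contra hwr
      linarith [hfirst w hw hwr, hvlast w hw hwr])
  refine exists_flip_of_paths hG hp hq hpq hl hm ?_ ?_ ?_ (hvuL _ _ (by simp) hvq.le)
  · refine hm.1.2.2.cons hm.2.1 fun e he => ?_
    obtain ⟨h1, h2⟩ := mem_of_mem_pathEdges he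
    exact Apart.of_exposed_edge (ε := 1) (by simpa only [one_mul] using hfirst)
      (hm.1.mem_iff.1 h1) (hm.1.mem_iff.1 h2) (ne_of_mem_pathEdges hm.1.1 he)
  · intro x hx y hy _
    have h1 : 0 < sign3 u p v := by rwa [← sign3_rotate]
    refine apart_of_sign3 u p h1.le (by simp) (by simpa using h1) ?_ ?_
    · rw [sign3_swap]; linarith [hR x hx]
    · rw [sign3_swap]; linarith [hR y hy]
  · exact fun x hx y hy _ => hvuL x y (hL x hx) (hL y hy)

/-- Two points on different sides of `pq` whose segment crosses the line `pq` beyond `q` can be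
chosen so that all other points of `S` lie on one side of their line. -/
theorem exists_supporting_edge {S : Finset Pt} (hG : GenPos S) {p q u₀ v₀ : Pt} (hp : p ∈ S)
    (hq : q ∈ S) (hpq : p ≠ q)
    (hpos : ∀ u ∈ rightOf S p q, ∀ v ∈ leftOf S p q, 0 < sign3 p u v)
    (hu₀ : u₀ ∈ rightOf S p q) (hv₀ : v₀ ∈ leftOf S p q) (h₀ : 0 < sign3 u₀ v₀ q) :
    ∃ u ∈ rightOf S p q, ∃ v ∈ leftOf S p q, ∀ w ∈ S, w ≠ u → w ≠ v → 0 < sign3 u v w := by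
  obtain ⟨⟨u, v⟩, huv, hmax⟩ := (rightOf S p q ×ˢ leftOf S p q).exists_max_image
    (fun x => sign3 p x.1 x.2 / (sign3 p q x.2 - sign3 p q x.1))
    ⟨(u₀, v₀), Finset.mem_product.2 ⟨hu₀, hv₀⟩⟩
  obtain ⟨hu, hv⟩ := Finset.mem_product.1 huv
  simp only at hu hv
  obtain ⟨huS, hqu⟩ := mem_rightOf.1 hu
  obtain ⟨hvS, hqv⟩ := mem_leftOf.1 hv
  have huv : u ≠ v := by rintro rfl; linarith
  replace hmax : ∀ a ∈ rightOf S p q, ∀ b ∈ leftOf S p q,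
      sign3 p a b * (sign3 p q v - sign3 p q u) ≤ sign3 p u v * (sign3 p q b - sign3 p q a) := by
    intro a ha b hb
    have h := hmax (a, b) (Finset.mem_product.2 ⟨ha, hb⟩)
    have ha' := (mem_rightOf.1 ha).2
    have hb' := (mem_leftOf.1 hb).2
    rwa [div_le_div_iff₀ (by linarith) (by linarith)] at h
  refine ⟨u, hu, v, hv, fun w hw hwu hwv => ?_⟩
  rcases eq_or_ne w p with rfl | hwp
  · rw [sign3_rotate]
    exact hpos u hu v hv
  rcases eq_or_ne w q with rfl | hwq
  · have h1 := hmax u₀ hu₀ v₀ hv₀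
    have e : ∀ a b, sign3 a b w = sign3 p a b - (sign3 p w b - sign3 p w a) := fun a b => by
      simp only [sign3]; ring
    rw [e] at h₀ ⊢
    have h2 := (mem_rightOf.1 hu₀).2
    have h3 := (mem_leftOf.1 hv₀).2
    have h4 : (sign3 p w v₀ - sign3 p w u₀) * (sign3 p w v - sign3 p w u) <
        sign3 p u v * (sign3 p w v₀ - sign3 p w u₀) :=
      (mul_lt_mul_of_pos_right (by linarith) (by linarith)).trans_le h1
    rw [mul_comm (sign3 p u v)] at h4
    linarith [lt_of_mul_lt_mul_left h4 (by linarith)]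
  have hne := hG.sign3_ne_zero huS hvS hw huv hwu.symm hwv.symm
  refine lt_of_le_of_ne' ?_ hne
  rcases (hG.sign3_ne_zero hp hq hw hpq hwp.symm hwq.symm).lt_or_gt with h | h
  · have h1 := hmax w (mem_rightOf.2 ⟨hw, h⟩) v hv
    have h2 : sign3 p u v * (sign3 p q v - sign3 p q w) -
        sign3 p w v * (sign3 p q v - sign3 p q u) = sign3 p q v * sign3 u v w := by
      simp only [sign3]; ring
    exact nonneg_of_mul_nonneg_right (by linarith : 0 ≤ sign3 p q v * sign3 u v w) hqv
  · have h1 := hmax u hu w (mem_leftOf.2 ⟨hw, h⟩)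
    have h2 : sign3 p u v * (sign3 p q w - sign3 p q u) -
        sign3 p u w * (sign3 p q v - sign3 p q u) = -sign3 p q u * sign3 u v w := by
      simp only [sign3]; ring
    exact nonneg_of_mul_nonneg_right (by linarith : 0 ≤ -sign3 p q u * sign3 u v w) (by linarith)

theorem exists_mem_pathEdges_of_mem {l : List Pt} (f : Pt → Prop) {a b : Pt} (ha : a ∈ l)
    (hb : b ∈ l) (hfa : f a) (hfb : ¬ f b) : ∃ e ∈ pathEdges l, f e.1 ↔ ¬ f e.2 := by
  induction l generalizing a b with
  | nil => simp at ha
  | cons x t ih =>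
    cases t with
    | nil =>
      rw [List.mem_singleton] at ha hb
      subst ha
      subst hb
      exact absurd hfa hfb
    | cons y t =>
      rw [pathEdges_cons (q := y) rfl]
      by_cases hxy : f x ↔ ¬ f y
      · exact ⟨(x, y), by simp, hxy⟩
      · have key : ∀ z ∈ x :: y :: t, ∃ z' ∈ y :: t, f z' ↔ f z := by
          intro z hz
          rcases List.mem_cons.1 hz with rfl | hz
          · exact ⟨y, by simp, by tauto⟩
          · exact ⟨z, hz, Iff.rfl⟩
        obtain ⟨a', ha', haa⟩ := key a ha
        obtain ⟨b', hb', hbb⟩ := key b hb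
        obtain ⟨e, he, h⟩ := ih ha' hb' (haa.2 hfa) (mt hbb.1 hfb)
        exact ⟨e, List.mem_cons_of_mem _ he, h⟩

theorem sign3_trans_of_leftOf_eq_empty {S : Finset Pt} (hG : GenPos S) {p m : Pt} (hp : p ∈ S)
    (hm : m ∈ S) (hmp : m ≠ p) (hE : leftOf S p m = ∅) {a b c : Pt} (ha : a ∈ S) (hb : b ∈ S)
    (hc : c ∈ S) (hab : 0 < sign3 p a b) (hbc : 0 < sign3 p b c) : 0 < sign3 p a c := by
  have hle : ∀ x ∈ S, sign3 p m x ≤ 0 := fun x hx => by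
    by_contra! h
    exact Finset.notMem_empty x (hE ▸ mem_leftOf.2 ⟨hx, h⟩)
  have hlt : ∀ x ∈ S, ∀ y ∈ S, 0 < sign3 p x y → sign3 p m x < 0 := fun x hx y hy h => by
    have hxp : x ≠ p := by rintro rfl; simp at h
    have hxm : x ≠ m := by rintro rfl; linarith [hle y hy]
    exact (hle x hx).lt_of_ne (hG.sign3_ne_zero hp hm hx hmp.symm hxp.symm hxm.symm)
  have h1 := sign3_plucker p m a b c
  have h2 := mul_neg_of_neg_of_pos (hlt a ha b hb hab) hbc
  have h3 := mul_nonpos_of_nonpos_of_nonneg (hle c hc) hab.le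
  exact pos_of_mul_neg_right (by linarith) (hlt b hb c hc hbc).le

/-- A plane spanning path starting with `pq` has an edge crossing the line `pq` beyond `q` if `S`
has points on both sides of that line and all segments between the sides pass in front of `p`. -/
theorem exists_edge_beyond {S : Finset Pt} (hG : GenPos S) {p q : Pt} {t : List Pt}
    (hP : IsPlanePath S (p :: q :: t))
    (hpos : ∀ u ∈ rightOf S p q, ∀ v ∈ leftOf S p q, 0 < sign3 p u v)
    (hR : (rightOf S p q).Nonempty) (hL : (leftOf S p q).Nonempty) :
    ∃ u ∈ rightOf S p q, ∃ v ∈ leftOf S p q, 0 < sign3 u v q := by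
  have hp : p ∈ S := hP.mem_iff.1 (by simp)
  have hq : q ∈ S := hP.mem_iff.1 (by simp)
  have hnd := hP.1
  simp only [List.nodup_cons, List.mem_cons, not_or] at hnd
  obtain ⟨⟨hpq, hpt⟩, hqt, hnt⟩ := hnd
  have htS : ∀ x ∈ t, x ∈ S := fun x hx => hP.mem_iff.1 (by simp [hx])
  have hmem : ∀ x ∈ S, sign3 p q x ≠ 0 → x ∈ t := fun x hx h => by
    obtain ⟨h1, h2⟩ := ne_of_sign3_ne_zero h
    simpa [h1, h2] using hP.mem_iff.2 hx
  have hne : ∀ x ∈ t, sign3 p q x ≠ 0 := fun x hx =>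
    hG.sign3_ne_zero hp hq (htS x hx) hpq (fun h => hpt (h ▸ hx)) (fun h => hqt (h ▸ hx))
  obtain ⟨a, ha⟩ := hL
  obtain ⟨b, hb⟩ := hR
  rw [mem_leftOf] at ha
  rw [mem_rightOf] at hb
  obtain ⟨e, he, hside⟩ := exists_mem_pathEdges_of_mem (fun x => 0 < sign3 p q x)
    (hmem a ha.1 ha.2.ne') (hmem b hb.1 hb.2.ne) ha.2 hb.2.le.not_gt
  obtain ⟨h1, h2⟩ := mem_of_mem_pathEdges he
  have hap : Apart p q e.1 e.2 := by
    have hnc := hP.2.2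
    rw [pathEdges_cons (q := q) rfl] at hnc
    refine (List.pairwise_cons.1 hnc).1 e ?_
    cases t with
    | nil => simp at h1
    | cons y t => exact List.mem_cons_of_mem _ he
  have key : ∀ u ∈ t, ∀ v ∈ t, sign3 p q u < 0 → 0 < sign3 p q v → Apart u v p q →
      ∃ u ∈ rightOf S p q, ∃ v ∈ leftOf S p q, 0 < sign3 u v q := by
    intro u hu v hv hqu hqv hap
    have hu' := mem_rightOf.2 ⟨htS u hu, hqu⟩
    have hv' := mem_leftOf.2 ⟨htS v hv, hqv⟩
    refine ⟨u, hu', v, hv', ?_⟩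
    have hpuv := hpos u hu' v hv'
    rw [← sign3_rotate] at hpuv
    by_contra! h
    refine not_apart_of_sign3 hqu hqv hpuv (h.lt_of_ne ?_) hap
    refine hG.sign3_ne_zero (htS u hu) (htS v hv) hq ?_ ?_ ?_
    · rintro rfl; linarith
    · exact (ne_of_sign3_ne_zero hqu.ne).2
    · exact (ne_of_sign3_ne_zero hqv.ne').2
  by_cases h : 0 < sign3 p q e.1
  · exact key _ h2 _ h1 ((not_lt.1 (hside.1 h)).lt_of_ne (hne _ h2)) h hap.symm.swap_left
  · exact key _ h1 _ h2 ((not_lt.1 h).lt_of_ne (hne _ h1)) (by_contra fun h' => h (hside.2 h'))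
      hap.symm

/-- If `p` is extreme and some plane spanning path starts with `pq`, then the edge `pq` can be
flipped to an edge `pr` with `r` left of `pq`, provided that there are points left of `pq`. -/
theorem exists_flip_of_extreme {S : Finset Pt} (hG : GenPos S) {p q m : Pt} {t : List Pt}
    (hm : m ∈ S) (hmp : m ≠ p) (hE : leftOf S p m = ∅) (hP : IsPlanePath S (p :: q :: t))
    (hL : (leftOf S p q).Nonempty) :
    ∃ r ∈ leftOf S p q, ∃ P Q : List Pt, P.head? = some p ∧ P.tail.head? = some q ∧
      Q.head? = some p ∧ Q.tail.head? = some r ∧ FlipAdj S P Q := by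
  have hp : p ∈ S := hP.mem_iff.1 (by simp)
  have hq : q ∈ S := hP.mem_iff.1 (by simp)
  have hpq : p ≠ q := by
    rintro rfl
    simpa using hP.1
  have hpos : ∀ u ∈ rightOf S p q, ∀ v ∈ leftOf S p q, 0 < sign3 p u v := by
    intro u hu v hv
    rw [mem_rightOf] at hu
    rw [mem_leftOf] at hv
    refine sign3_trans_of_leftOf_eq_empty hG hp hm hmp hE hu.1 hq hv.1 ?_ hv.2
    rw [sign3_swap_right]
    linarith
  obtain ⟨u, hu, v, hv, huR, hside⟩ : ∃ u ∈ insert q (rightOf S p q), ∃ v ∈ leftOf S p q,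
      (q = u → rightOf S p q = ∅) ∧ ∀ w ∈ S, w ≠ u → w ≠ v → 0 < sign3 u v w := by
    rcases (rightOf S p q).eq_empty_or_nonempty with hR | hR
    · obtain ⟨v, hv, hvfirst⟩ : ∃ c ∈ leftOf S p q, ∀ w ∈ leftOf S p q, w ≠ c →
          0 < 1 * sign3 q c w :=
        exists_radial_first (by simp [mem_leftOf]) hL (hG.mono (insert_leftOf_subset hq))
          (exposed_of_sign3_pos p q (by simp) fun w hw _ => (mem_leftOf.1 hw).2) one_ne_zero
      refine ⟨q, by simp, v, hv, fun _ => hR, fun w hw hwq hwv => ?_⟩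
      rcases eq_or_ne w p with rfl | hwp
      · rw [sign3_rotate]
        exact (mem_leftOf.1 hv).2
      rcases (hG.sign3_ne_zero hp hq hw hpq hwp.symm hwq.symm).lt_or_gt with h | h
      · exact absurd (hR ▸ mem_rightOf.2 ⟨hw, h⟩) (Finset.notMem_empty w)
      · simpa using hvfirst w (mem_leftOf.2 ⟨hw, h⟩) hwv
    · obtain ⟨u₀, hu₀, v₀, hv₀, h₀⟩ := exists_edge_beyond hG hP hpos hR hL
      obtain ⟨u, hu, v, hv, h⟩ := exists_supporting_edge hG hp hq hpq hpos hu₀ hv₀ h₀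
      refine ⟨u, Finset.mem_insert_of_mem hu, v, hv, ?_, h⟩
      rintro rfl
      simp [mem_rightOf] at hu
  have hvR : v ∉ insert q (rightOf S p q) := fun h => by
    have h1 := (mem_leftOf.1 hv).2
    rcases Finset.mem_insert.1 h with rfl | h
    · simp at h1
    · linarith [(mem_rightOf.1 h).2]
  have huL : u ∉ insert p (leftOf S p q) := fun h => by
    rcases Finset.mem_insert.1 h with rfl | h
    · simp [mem_rightOf, hpq] at hu
    · have h1 := (mem_leftOf.1 h).2
      rcases Finset.mem_insert.1 hu with rfl | h
      · simp at h1
      · linarith [(mem_rightOf.1 h).2]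
  have hvp : v ≠ p := by
    rintro rfl
    simp [mem_leftOf] at hv
  have hnonneg : ∀ x ∈ S, 0 ≤ sign3 u v x := fun x hx => by
    rcases eq_or_ne x u with rfl | hxu
    · simp
    rcases eq_or_ne x v with rfl | hxv
    · simp
    exact (hside x hx hxu hxv).le
  have hap : ∀ x ∈ S, ∀ y ∈ S, (x ≠ u ∧ x ≠ v) ∨ (y ≠ u ∧ y ≠ v) → Apart v u x y := by
    intro x hx y hy h
    refine (apart_of_sign3 u v (hnonneg x hx) (hnonneg y hy) ?_ (by simp) (by simp)).symm
    rcases h with h | h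
    · linarith [hside x hx h.1 h.2, hnonneg y hy]
    · linarith [hside y hy h.1 h.2, hnonneg x hx]
  obtain ⟨l, hl⟩ := exists_pathBetween (hG.mono (insert_rightOf_subset hq))
    (Finset.mem_insert_self q (rightOf S p q)) hu (exposed_right p q)
    fun h => by rw [huR h]; rfl
  obtain ⟨k, hk, hkp, hkv⟩ := exists_pathBetween (hG.mono (insert_leftOf_subset hp))
    (Finset.mem_insert_self p (leftOf S p q)) (Finset.mem_insert_of_mem hv) (exposed_left p q)
    fun h => absurd h.symm hvp
  obtain ⟨n, rfl⟩ : ∃ n, k = p :: n := by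
    cases k with
    | nil => simp at hkp
    | cons x n => exact ⟨n, by simpa using hkp⟩
  cases n with
  | nil => exact absurd (by simpa using hkv.symm) hvp
  | cons r n =>
  have hpn := (List.nodup_cons.1 hk.1).1
  have hn : IsPlanePath (leftOf S p q) (r :: n) := by
    refine ⟨hk.1.of_cons, ?_, ?_⟩
    · have h := congrArg (fun T => Finset.erase T p) hk.2.1
      rw [List.toFinset_cons] at h
      simpa only [Finset.erase_insert (mt List.mem_toFinset.1 hpn),
        Finset.erase_insert (show p ∉ leftOf S p q by simp [mem_leftOf])] using h
    · have h := hk.2.2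
      rw [pathEdges_cons (q := r) rfl] at h
      exact (List.pairwise_cons.1 h).2
  refine ⟨r, hn.mem_iff.1 (by simp), exists_flip_of_paths hG hp hq hpq hl
    ⟨hn, rfl, by simpa using hkv⟩ hk.2.2 ?_ ?_ ?_⟩
  · intro x hx y hy hxy
    have hxv : x ≠ v := fun h => hvR (h ▸ hx)
    have hyv : y ≠ v := fun h => hvR (h ▸ hy)
    refine hap x (insert_rightOf_subset hq hx) y (insert_rightOf_subset hq hy) ?_
    by_cases h : x = u
    · exact Or.inr ⟨fun h' => hxy (h.trans h'.symm), hyv⟩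
    · exact Or.inl ⟨h, hxv⟩
  · intro x hx y hy hxy
    have hxu : x ≠ u := fun h => huL (h ▸ hx)
    have hyu : y ≠ u := fun h => huL (h ▸ hy)
    refine hap x (insert_leftOf_subset hp hx) y (insert_leftOf_subset hp hy) ?_
    by_cases h : x = v
    · exact Or.inr ⟨hyu, fun h' => hxy (h.trans h'.symm)⟩
    · exact Or.inl ⟨hxu, h⟩
  · exact hap p hp q hq (Or.inl ⟨fun h => huL (h ▸ Finset.mem_insert_self _ _), hvp.symm⟩)

/-- If for every point set in general position and all distinct `p, q` the flip
graph on plane spanning paths starting with the edge `pq` is connected, then for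
every such set and every `p` the flip graph on paths starting at `p` is connected. -/
theorem stmt_5
    (H : ∀ S : Finset Pt, GenPos S → ∀ p ∈ S, ∀ q ∈ S, p ≠ q →
      FlipConnected S (fun l => l.head? = some p ∧ l.tail.head? = some q)) :
    ∀ S : Finset Pt, GenPos S → ∀ p ∈ S,
      FlipConnected S (fun l => l.head? = some p) := by
  intro S hG p hp P Q hP hPp hQ hQp
  have second : ∀ P, IsPlanePath S P → P.head? = some p → (∃ x ∈ S, x ≠ p) →
      ∃ q t, P = p :: q :: t ∧ q ∈ S ∧ q ≠ p := by
    rintro P hP hPp ⟨x, hx, hxp⟩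
    match P with
    | [] => simp at hPp
    | [y] =>
      obtain rfl : y = p := by simpa using hPp
      exact absurd (by simpa using hP.mem_iff.2 hx) hxp
    | y :: q :: t =>
      obtain rfl : y = p := by simpa using hPp
      refine ⟨q, t, rfl, hP.mem_iff.1 (by simp), ?_⟩
      rintro rfl
      simpa using hP.1
  by_cases hS : ∃ x ∈ S, x ≠ p
  swap
  · have single : ∀ P, IsPlanePath S P → P.head? = some p → P = [p] := by
      intro P hP hPp
      match P with
      | [] => simp at hPp
      | [y] =>
        obtain rfl : y = p := by simpa using hPp
        rfl
      | y :: q :: t =>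
        obtain rfl : y = p := by simpa using hPp
        refine absurd ⟨q, hP.mem_iff.1 (by simp), ?_⟩ hS
        rintro rfl
        simpa using hP.1
    rw [single P hP hPp, single Q hQ hQp]
    refine ⟨0, fun _ => [p], rfl, rfl, fun i _ => ⟨single P hP hPp ▸ hP, rfl⟩, fun i hi => ?_⟩
    exact absurd hi (Nat.not_lt_zero i)
  have same : ∀ P Q q, q ∈ S → q ≠ p → IsPlanePath S P → IsPlanePath S Q → P.head? = some p →
      Q.head? = some p → P.tail.head? = some q → Q.tail.head? = some q →
      ∃ k, FlipSeq S (fun l => l.head? = some p) k P Q := by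
    intro P Q q hq hqp hP hQ hPp hQp hPq hQq
    obtain ⟨k, hk⟩ := H S hG p hp q hq hqp.symm P Q hP ⟨hPp, hPq⟩ hQ ⟨hQp, hQq⟩
    exact ⟨k, hk.mono fun l hl => hl.1⟩
  obtain ⟨q, t, rfl, hq, hqp⟩ := second P hP hPp hS
  obtain ⟨q', t', rfl, hq', hqp'⟩ := second Q hQ hQp hS
  by_cases hE : ∃ m ∈ S, m ≠ p ∧ leftOf S p m = ∅
  · obtain ⟨m, hm, hmp, hE⟩ := hE
    have last : ∀ q t, IsPlanePath S (p :: q :: t) → q ∈ S → q ≠ p → ∃ q' t', q' ∈ S ∧ q' ≠ p ∧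
        leftOf S p q' = ∅ ∧ IsPlanePath S (p :: q' :: t') ∧
        ∃ k, FlipSeq S (fun l => l.head? = some p) k (p :: q :: t) (p :: q' :: t') := by
      intro q t hP hq hqp
      induction hn : (leftOf S p q).card using Nat.strong_induction_on generalizing q t with
      | _ n ih =>
      subst hn
      rcases (leftOf S p q).eq_empty_or_nonempty with hL | hL
      · obtain ⟨k, hk⟩ := same _ _ q hq hqp hP hP rfl rfl rfl rfl
        exact ⟨q, t, hq, hqp, hL, hP, k, hk⟩
      obtain ⟨r, hr, P₁, P₂, h1p, h1q, h2p, h2r, hflip⟩ :=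
        exists_flip_of_extreme hG hm hmp hE hP hL
      obtain ⟨r', t₂, rfl, hrS, hrp⟩ := second P₂ hflip.2.1 h2p hS
      obtain rfl : r' = r := by simpa using h2r
      have hlt : (leftOf S p r').card < (leftOf S p q).card := by
        refine Finset.card_lt_card ⟨fun w hw => ?_, fun h => ?_⟩
        · rw [mem_leftOf] at hw ⊢
          exact ⟨hw.1, sign3_trans_of_leftOf_eq_empty hG hp hm hmp hE hq hrS hw.1
            (mem_leftOf.1 hr).2 hw.2⟩
        · simpa [mem_leftOf] using h hr
      obtain ⟨q', t', hq', hqp', hL', hP', k, hk⟩ := ih _ hlt r' t₂ hflip.2.1 hrS hrp rfl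
      obtain ⟨j, hj⟩ := same _ _ q hq hqp hP hflip.1 rfl h1p rfl h1q
      exact ⟨q', t', hq', hqp', hL', hP', _, (hj.trans (FlipSeq.single hflip h1p rfl)).trans hk⟩
    obtain ⟨a, s, ha, hap, hLa, hPa, j, hj⟩ := last q t hP hq hqp
    obtain ⟨b, s', hb, hbp, hLb, hPb, k, hk⟩ := last q' t' hQ hq' hqp'
    obtain rfl : a = b := by
      by_contra hab
      rcases (hG.sign3_ne_zero hp ha hb hap.symm hbp.symm hab).lt_or_gt with h | h
      · refine Finset.notMem_empty a (hLb ▸ mem_leftOf.2 ⟨ha, ?_⟩)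
        rw [sign3_swap_right]
        linarith
      · exact Finset.notMem_empty b (hLa ▸ mem_leftOf.2 ⟨hb, h⟩)
    obtain ⟨i, hi⟩ := same _ _ a ha hap hPa hPb rfl rfl rfl rfl
    exact ⟨_, (hj.trans hi).trans (hk.symm hPb rfl)⟩
  have hI : ∀ m ∈ S, m ≠ p → (leftOf S p m).Nonempty := fun m hm hmp =>
    Finset.nonempty_iff_ne_empty.2 fun h => hE ⟨m, hm, hmp, h⟩
  have left : ∀ q t r s, IsPlanePath S (p :: q :: t) → q ∈ S → q ≠ p →
      IsPlanePath S (p :: r :: s) → r ∈ leftOf S p q →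
      ∃ k, FlipSeq S (fun l => l.head? = some p) k (p :: q :: t) (p :: r :: s) := by
    intro q t r s hP hq hqp hQ hr
    induction hn : ((leftOf S p q).filter fun w => 0 < sign3 p w r).card
      using Nat.strong_induction_on generalizing q t with
    | _ n ih =>
    subst hn
    obtain ⟨c, hc, hfirst⟩ := exists_first_left hG hp ⟨r, hr⟩ one_ne_zero
    simp only [one_mul] at hfirst
    obtain ⟨P₁, P₂, h1p, h1q, h2p, h2c, hflip⟩ :=
      exists_flip_of_surrounded hG hp hI hq hqp.symm hc hfirst
    obtain ⟨j, hj⟩ := same _ _ q hq hqp hP hflip.1 rfl h1p rfl h1q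
    have hj' := hj.trans (FlipSeq.single hflip h1p h2p)
    obtain ⟨c', t₂, rfl, hcS, hcp⟩ := second P₂ hflip.2.1 h2p hS
    obtain rfl : c' = c := by simpa using h2c
    rcases eq_or_ne r c' with rfl | hrc
    · obtain ⟨i, hi⟩ := same _ _ r hcS hcp hflip.2.1 hQ rfl rfl rfl rfl
      exact ⟨_, hj'.trans hi⟩
    have hcr := hfirst r hr hrc
    have hlt : ((leftOf S p c').filter fun w => 0 < sign3 p w r).card <
        ((leftOf S p q).filter fun w => 0 < sign3 p w r).card := by
      refine Finset.card_lt_card ⟨fun w hw => ?_, fun h => ?_⟩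
      · rw [Finset.mem_filter, mem_leftOf] at hw ⊢
        obtain ⟨⟨hw, hcw⟩, hwr⟩ := hw
        refine ⟨⟨hw, ?_⟩, hwr⟩
        have h1 := sign3_plucker p q c' w r
        have h2 := mul_pos (mem_leftOf.1 hc).2 hwr
        have h3 := mul_pos (mem_leftOf.1 hr).2 hcw
        exact pos_of_mul_pos_left (by linarith) hcr.le
      · have h1 := (Finset.mem_filter.1 (h (Finset.mem_filter.2 ⟨hc, hcr⟩))).1
        simp [mem_leftOf] at h1
    obtain ⟨k, hk⟩ := ih _ hlt c' t₂ hflip.2.1 hcS hcp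
      (mem_leftOf.2 ⟨(mem_leftOf.1 hr).1, hcr⟩) rfl
    exact ⟨_, hj'.trans hk⟩
  rcases eq_or_ne q q' with rfl | hne
  · exact same _ _ q hq hqp hP hQ rfl rfl rfl rfl
  rcases (hG.sign3_ne_zero hp hq hq' hqp.symm hqp'.symm hne).lt_or_gt with h | h
  · obtain ⟨k, hk⟩ := left q' t' q t hQ hq' hqp' hP (mem_leftOf.2 ⟨hq, by
      rw [sign3_swap_right]
      linarith⟩)
    exact ⟨k, hk.symm hP rfl⟩
  · exact left q t q' t' hP hq hqp hQ (mem_leftOf.2 ⟨hq', h⟩)
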